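/- For the fixed-energy Manna model on the cycle C_n with initial heights i.i.d. Poisson(ρ), the following hold: for every ρ < 1, the probability that the initial state is stabilizable tends to 1 as n → ∞; and for every ρ > 1, this probability tends to 0 as n → ∞. Consequently the threshold density of the Manna model, ρ_th = lim_{n→∞} sup{ρ > 0 : P(stabilizable) ≥ 1/2}, equals 1. -/

import Mathlib

open MeasureTheory Filter Topology

/-- Toppling labels of the Manna model: `l` (both particles to the left),
`r` (both to the right) and `s` (one to each neighbor). -/
inductive Label3 : Type
  | l : Label3
  | r : Label3
  | s : Label3
deriving DecidableEq

instance : MeasurableSpace Label3 := ⊤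

/-- The probability of each label in a Manna stack: `s` with probability `1/2`,
`l` and `r` with probability `1/4` each. -/
noncomputable def labelP : Label3 → ENNReal
  | Label3.s => 1 / 2
  | Label3.l => 1 / 4
  | Label3.r => 1 / 4

/-- A Manna state on the cycle `C_n` (vertex set `ZMod (n+1)`): the height
configuration together with, for each site, the number of labels of its stack
already consumed. -/
abbrev MannaState (n : ℕ) := (ZMod (n + 1) → ℕ) × (ZMod (n + 1) → ℕ)

/-- One legal Manna toppling on the cycle in the stack environment `σ`: an
unstable site `x` (height `≥ 2`) consumes the next label of its stack and sends
its two particles accordingly (both to `x+1` for `r`, both to `x-1` for `l`,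
one to each neighbor for `s`). -/
def MannaStep (n : ℕ) (σ : ZMod (n + 1) → ℕ → Label3)
    (p q : MannaState n) : Prop :=
  ∃ x, 2 ≤ p.1 x ∧
    q.1 = (fun y =>
      (p.1 y - if y = x then 2 else 0)
        + (if σ x (p.2 x) = Label3.r ∧ y = x + 1 then 2 else 0)
        + (if σ x (p.2 x) = Label3.l ∧ y = x - 1 then 2 else 0)
        + (if σ x (p.2 x) = Label3.s ∧ y = x - 1 then 1 else 0)
        + (if σ x (p.2 x) = Label3.s ∧ y = x + 1 then 1 else 0)) ∧
    q.2 = Function.update p.2 x (p.2 x + 1)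

/-- A Manna state is stabilizable if some finite sequence of legal topplings
reaches a stable configuration (all heights `≤ 1`). -/
def MannaStabilizable (n : ℕ) (η : ZMod (n + 1) → ℕ)
    (σ : ZMod (n + 1) → ℕ → Label3) : Prop :=
  ∃ q : MannaState n,
    Relation.ReflTransGen (MannaStep n σ) (η, fun _ => 0) q ∧ ∀ y, q.1 y ≤ 1

section Combinatorics

open Relation

variable {n : ℕ}

/-- The configuration with a single particle, located at `x`. -/
def oneAt (x : ZMod (n + 1)) : ZMod (n + 1) → ℕ := Pi.single x 1

/-- The two particles emitted by a toppling at `x` with a given label. -/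
def emitted (x : ZMod (n + 1)) : Label3 → ZMod (n + 1) → ℕ
  | Label3.l => oneAt (x - 1) + oneAt (x - 1)
  | Label3.r => oneAt (x + 1) + oneAt (x + 1)
  | Label3.s => oneAt (x - 1) + oneAt (x + 1)

/-- A toppling of some unstable site with some label, irrespective of the stacks. -/
def Topples (η η' : ZMod (n + 1) → ℕ) : Prop :=
  ∃ b x a, η = b + oneAt x + oneAt x ∧ η' = b + emitted x a

lemma exists_eq_add_oneAt {η : ZMod (n + 1) → ℕ} {x : ZMod (n + 1)} (h : η x ≠ 0) :
    ∃ b, η = b + oneAt x := by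
  refine ⟨η - oneAt x, ?_⟩
  funext y
  by_cases hy : y = x
  · subst hy
    simp only [oneAt, Pi.add_apply, Pi.sub_apply, Pi.single_eq_same]
    omega
  · simp [oneAt, hy]

lemma exists_eq_add_oneAt_add_oneAt {η : ZMod (n + 1) → ℕ} {x : ZMod (n + 1)} (h : 2 ≤ η x) :
    ∃ b, η = b + oneAt x + oneAt x := by
  obtain ⟨b, rfl⟩ := exists_eq_add_oneAt (η := η) (x := x) (by omega)
  obtain ⟨c, rfl⟩ := exists_eq_add_oneAt (η := b) (x := x) (by
    simp [oneAt] at h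
    omega)
  exact ⟨c, rfl⟩

lemma sum_oneAt (x : ZMod (n + 1)) : ∑ y, oneAt x y = 1 := by
  simp [oneAt]

lemma sum_emitted (x : ZMod (n + 1)) (a : Label3) : ∑ y, emitted x a y = 2 := by
  cases a <;> simp [emitted, Finset.sum_add_distrib, sum_oneAt]

lemma Topples.sum_eq {η η' : ZMod (n + 1) → ℕ} (h : Topples η η') :
    ∑ y, η' y = ∑ y, η y := by
  obtain ⟨b, x, a, rfl, rfl⟩ := h
  simp [Finset.sum_add_distrib, sum_oneAt, sum_emitted]

lemma reflTransGen_topples_sum_eq {η η' : ZMod (n + 1) → ℕ}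
    (h : ReflTransGen Topples η η') : ∑ y, η' y = ∑ y, η y := by
  induction h with
  | refl => rfl
  | tail _ h ih => rw [h.sum_eq, ih]

/-- The number of empty sites. -/
def holes (η : ZMod (n + 1) → ℕ) : ℕ := (Finset.univ.filter fun y => η y = 0).card

lemma holes_add_oneAt_of_eq_zero {b : ZMod (n + 1) → ℕ} {x : ZMod (n + 1)} (h : b x = 0) :
    holes (b + oneAt x) + 1 = holes b := by
  have : (Finset.univ.filter fun y => (b + oneAt x) y = 0) =
      (Finset.univ.filter fun y => b y = 0).erase x := by
    ext y
    by_cases hy : y = x <;> simp [oneAt, hy]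
  rw [holes, this, holes]
  exact Finset.card_erase_add_one (by simp [h])

lemma holes_add_oneAt_of_ne_zero {b : ZMod (n + 1) → ℕ} {x : ZMod (n + 1)} (h : b x ≠ 0) :
    holes (b + oneAt x) = holes b := by
  unfold holes
  congr 1
  ext y
  by_cases hy : y = x <;> simp [oneAt, hy, h]

lemma card_le_holes_add_sum (b : ZMod (n + 1) → ℕ) : n + 1 ≤ holes b + ∑ y, b y := by
  have h1 : holes b + (Finset.univ.filter fun y => ¬ b y = 0).card = n + 1 := by
    rw [holes, Finset.card_filter_add_card_filter_not, Finset.card_univ, ZMod.card]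
  have h2 : (Finset.univ.filter fun y => ¬ b y = 0).card ≤ ∑ y, b y := by
    rw [Finset.card_filter]
    refine Finset.sum_le_sum fun y _ => ?_
    split_ifs <;> omega
  omega

/-- A pair of particles can be carried to any site without changing the rest. -/
lemma reflTransGen_topples_pair (b : ZMod (n + 1) → ℕ) (x z : ZMod (n + 1)) :
    ReflTransGen Topples (b + oneAt x + oneAt x) (b + oneAt z + oneAt z) := by
  have key : ∀ k : ℕ, ReflTransGen Topples (b + oneAt x + oneAt x)
      (b + oneAt (x + (k : ZMod (n + 1))) + oneAt (x + (k : ZMod (n + 1)))) := by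
    intro k
    induction k with
    | zero => simpa using ReflTransGen.refl
    | succ k ih =>
      refine ih.tail ⟨b, x + k, Label3.r, rfl, ?_⟩
      simp [emitted, add_assoc]
  simpa using key (z - x).val

/-- A pair of particles can be carried to `u + 1` and split there. -/
lemma reflTransGen_topples_split (b : ZMod (n + 1) → ℕ) (x u : ZMod (n + 1)) :
    ReflTransGen Topples (b + oneAt x + oneAt x) (b + oneAt u + oneAt (u + 2)) := by
  refine (reflTransGen_topples_pair b x (u + 1)).tail ⟨b, u + 1, Label3.s, rfl, ?_⟩
  have : u + 1 + 1 = u + 2 := by ring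
  simp [emitted, add_assoc, this]

lemma exists_reflTransGen_topples_holes_add_two_le (d : ℕ) :
    ∀ (b : ZMod (n + 1) → ℕ) (u x : ZMod (n + 1)), b u = 0 → b (u + 2 * (d + 1)) = 0 →
      u ≠ u + 2 * (d + 1) →
      ∃ η', ReflTransGen Topples (b + oneAt x + oneAt x) η' ∧ holes η' + 2 ≤ holes b := by
  have adjacent : ∀ (b : ZMod (n + 1) → ℕ) (u x : ZMod (n + 1)), b u = 0 → b (u + 2) = 0 →
      u ≠ u + 2 →
      ∃ η', ReflTransGen Topples (b + oneAt x + oneAt x) η' ∧ holes η' + 2 ≤ holes b := by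
    intro b u x hu hv huv
    refine ⟨_, reflTransGen_topples_split b x u, ?_⟩
    have h1 := holes_add_oneAt_of_eq_zero hu
    have h2 := holes_add_oneAt_of_eq_zero (b := b + oneAt u) (x := u + 2)
      (by simp only [oneAt, Pi.add_apply, hv, Pi.single_eq_of_ne huv.symm, add_zero])
    omega
  induction d with
  | zero =>
    intro b u x hu hv huv
    simp only [Nat.cast_zero, zero_add, mul_one] at hv huv
    exact adjacent b u x hu hv huv
  | succ d ih =>
    intro b u x hu hv huv
    have hw : u + 2 * (((d + 1 : ℕ) : ZMod (n + 1)) + 1) = u + 2 + 2 * (d + 1) := by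
      push_cast
      ring
    rw [hw] at hv huv
    by_cases he : u + 2 = u + 2 + 2 * (d + 1)
    · rw [← he] at hv huv
      exact adjacent b u x hu hv huv
    by_cases h0 : b (u + 2) = 0
    · exact ih b (u + 2) x h0 hv he
    have hne : u ≠ u + 2 := by
      intro h
      rw [← h] at h0
      exact h0 hu
    obtain ⟨c, rfl⟩ := exists_eq_add_oneAt h0
    have hcu : c u = 0 := by simpa [oneAt, hne] using hu
    have hcv : c (u + 2 + 2 * (d + 1)) = 0 := by
      have := hv
      simp only [Pi.add_apply, Nat.add_eq_zero_iff] at this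
      exact this.1
    have h1 := holes_add_oneAt_of_eq_zero hcu
    have hmove : ReflTransGen Topples (c + oneAt (u + 2) + oneAt x + oneAt x)
        (c + oneAt u + oneAt (u + 2) + oneAt (u + 2)) := by
      convert reflTransGen_topples_split (c + oneAt (u + 2)) x u using 1
      abel
    have hv' : (c + oneAt u) (u + 2 + 2 * (d + 1)) = 0 := by
      simp only [oneAt, Pi.add_apply, hcv, Pi.single_eq_of_ne huv.symm, add_zero]
    by_cases hc : c (u + 2) = 0
    · have h2 := holes_add_oneAt_of_eq_zero hc
      obtain ⟨η', hη', hh⟩ := ih (c + oneAt u) (u + 2) (u + 2)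
        (by simp only [oneAt, Pi.add_apply, hc, Pi.single_eq_of_ne hne.symm, add_zero]) hv' he
      exact ⟨η', hmove.trans hη', by omega⟩
    · have h2 := holes_add_oneAt_of_ne_zero hc
      have h3 := holes_add_oneAt_of_eq_zero hv'
      refine ⟨_, hmove.trans (reflTransGen_topples_pair (c + oneAt u) (u + 2)
        (u + 2 + 2 * (d + 1))), ?_⟩
      rw [holes_add_oneAt_of_ne_zero (b := c + oneAt u + _) (by simp [oneAt])]
      omega

lemma exists_even_gap_of_two_lt_card {s : Finset (ZMod (n + 1))} (hs : 2 < s.card) :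
    ∃ u ∈ s, ∃ d : ℕ, u + 2 * (d + 1) ∈ s ∧ u ≠ u + 2 * (d + 1) := by
  obtain ⟨a, ha, c, hc, hne, hpar⟩ := Finset.exists_ne_map_eq_of_card_lt_of_maps_to
    (s := s) (t := Finset.range 2) (f := fun u => u.val % 2) (by simpa using hs)
    (fun u _ => by simpa using Nat.mod_lt u.val two_pos)
  have key : ∀ a ∈ s, ∀ c ∈ s, a.val % 2 = c.val % 2 → a.val < c.val →
      ∃ u ∈ s, ∃ d : ℕ, u + 2 * (d + 1) ∈ s ∧ u ≠ u + 2 * (d + 1) := by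
    intro a ha c hc hpar hlt
    obtain ⟨d, hd⟩ : ∃ d, c.val = a.val + 2 * (d + 1) := ⟨(c.val - a.val) / 2 - 1, by omega⟩
    have hac : c = a + 2 * (d + 1) := by
      have := congrArg (Nat.cast : ℕ → ZMod (n + 1)) hd
      simpa using this
    refine ⟨a, ha, d, hac ▸ hc, ?_⟩
    rw [← hac]
    rintro rfl
    exact lt_irrefl _ hlt
  rcases lt_trichotomy a.val c.val with h | h | h
  · exact key a ha c hc hpar h
  · exact absurd (ZMod.val_injective _ h) hne
  · exact key c hc a ha hpar.symm h

/-- With fewer particles than sites, suitable labels lead to a stable configuration. -/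
lemma exists_reflTransGen_topples_stable (η : ZMod (n + 1) → ℕ) (h : ∑ y, η y ≤ n) :
    ∃ ζ, ReflTransGen Topples η ζ ∧ ∀ y, ζ y ≤ 1 := by
  induction hk : holes η using Nat.strong_induction_on generalizing η with
  | _ k ih =>
    by_cases hst : ∀ y, η y ≤ 1
    · exact ⟨η, .refl, hst⟩
    push Not at hst
    obtain ⟨x, hx⟩ := hst
    obtain ⟨b, rfl⟩ := exists_eq_add_oneAt_add_oneAt hx
    have hcard := card_le_holes_add_sum b
    simp only [Pi.add_apply, Finset.sum_add_distrib, sum_oneAt] at h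
    obtain ⟨u, hu, d, hd, hne⟩ := exists_even_gap_of_two_lt_card
      (s := Finset.univ.filter fun y => b y = 0) (by
        change 2 < holes b
        omega)
    obtain ⟨η', hη', hh⟩ := exists_reflTransGen_topples_holes_add_two_le d b u x
      (by simpa using hu) (by simpa using hd) hne
    have h2 := holes_add_oneAt_of_ne_zero (b := b + oneAt x) (x := x) (by simp [oneAt])
    have h3 : holes b ≤ holes (b + oneAt x) + 1 := by
      by_cases hb : b x = 0
      · exact (holes_add_oneAt_of_eq_zero hb).ge
      · rw [holes_add_oneAt_of_ne_zero hb]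
        omega
    have hsum := reflTransGen_topples_sum_eq hη'
    simp only [Pi.add_apply, Finset.sum_add_distrib, sum_oneAt] at hsum
    obtain ⟨ζ, hζ, hs⟩ := ih (holes η') (by omega) η' (by omega) rfl
    exact ⟨ζ, hη'.trans hζ, hs⟩

lemma MannaStep.iff_exists {σ : ZMod (n + 1) → ℕ → Label3} {p q : MannaState n} :
    MannaStep n σ p q ↔ ∃ b x, p.1 = b + oneAt x + oneAt x ∧
      q.1 = b + emitted x (σ x (p.2 x)) ∧ q.2 = Function.update p.2 x (p.2 x + 1) := by
  obtain ⟨η, c⟩ := p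
  have key : ∀ (b : ZMod (n + 1) → ℕ) (x : ZMod (n + 1)) (a : Label3),
      (fun y => ((b + oneAt x + oneAt x) y - if y = x then 2 else 0)
        + (if a = Label3.r ∧ y = x + 1 then 2 else 0)
        + (if a = Label3.l ∧ y = x - 1 then 2 else 0)
        + (if a = Label3.s ∧ y = x - 1 then 1 else 0)
        + (if a = Label3.s ∧ y = x + 1 then 1 else 0)) = b + emitted x a := by
    intro b x a
    funext y
    have : (b + oneAt x + oneAt x) y - (if y = x then 2 else 0) = b y := by
      by_cases hy : y = x <;> simp [oneAt, hy]
    rw [this]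
    cases a <;> simp only [emitted, oneAt, Pi.add_apply, Pi.single_apply, reduceCtorEq, true_and,
      false_and, if_false, add_zero, add_assoc, Nat.add_left_cancel_iff] <;> split_ifs <;> rfl
  constructor
  · rintro ⟨x, hx, h1, h2⟩
    obtain ⟨b, rfl⟩ := exists_eq_add_oneAt_add_oneAt hx
    exact ⟨b, x, rfl, h1.trans (key b x _), h2⟩
  · rintro ⟨b, x, rfl, h1, h2⟩
    exact ⟨x, by simp [oneAt, add_assoc], h1.trans (key b x _).symm, h2⟩

lemma MannaStabilizable.sum_le {η : ZMod (n + 1) → ℕ} {σ : ZMod (n + 1) → ℕ → Label3}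
    (h : MannaStabilizable n η σ) : ∑ y, η y ≤ n + 1 := by
  obtain ⟨q, hq, hs⟩ := h
  have h1 : ∑ y, q.1 y = ∑ y, η y := reflTransGen_topples_sum_eq <|
    ReflTransGen.lift (p := Topples) (Prod.fst : MannaState n → _) (fun p p' hp => by
      obtain ⟨b, x, h1, h2, -⟩ := MannaStep.iff_exists.1 hp
      exact ⟨b, x, _, h1, h2⟩) _ _ hq
  rw [← h1]
  calc ∑ y, q.1 y ≤ ∑ _y : ZMod (n + 1), 1 := Finset.sum_le_sum fun y _ => hs y
    _ = n + 1 := by simp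

/-- Putting the label `a` on top of a stack. -/
def pushLabel (a : Label3) (f : ℕ → Label3) : ℕ → Label3
  | 0 => a
  | k + 1 => f k

/-- Putting the label `a` on top of the stack of the site `x`. -/
def pushAt (x : ZMod (n + 1)) (a : Label3) (σ : ZMod (n + 1) → ℕ → Label3) :
    ZMod (n + 1) → ℕ → Label3 :=
  Function.update σ x (pushLabel a (σ x))

/-- Removing the top label of the stack of the site `x`. -/
def popAt (x : ZMod (n + 1)) (σ : ZMod (n + 1) → ℕ → Label3) : ZMod (n + 1) → ℕ → Label3 :=
  Function.update σ x fun k => σ x (k + 1)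

lemma popAt_pushAt (x : ZMod (n + 1)) (a : Label3) (σ : ZMod (n + 1) → ℕ → Label3) :
    popAt x (pushAt x a σ) = σ := by
  simp [popAt, pushAt, pushLabel]

/-- Toppling once and then stabilizing with the remaining stacks stabilizes. -/
lemma MannaStabilizable.of_popAt {b : ZMod (n + 1) → ℕ} {x : ZMod (n + 1)}
    {σ : ZMod (n + 1) → ℕ → Label3}
    (h : MannaStabilizable n (b + emitted x (σ x 0)) (popAt x σ)) :
    MannaStabilizable n (b + oneAt x + oneAt x) σ := by
  obtain ⟨q, hq, hs⟩ := h
  have hpop : ∀ y k, popAt x σ y k = σ y (k + oneAt x y) := by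
    intro y k
    by_cases hy : y = x
    · subst hy
      simp [popAt, oneAt]
    · simp [popAt, oneAt, hy]
  refine ⟨(q.1, q.2 + oneAt x), .head ?_ (ReflTransGen.lift (p := MannaStep n σ)
    (fun p : MannaState n => (p.1, p.2 + oneAt x)) ?_ _ _ hq), hs⟩
  · refine MannaStep.iff_exists.2 ⟨b, x, rfl, rfl, ?_⟩
    funext y
    by_cases hy : y = x <;> simp [oneAt, hy]
  · intro p q hpq
    obtain ⟨c, z, h1, h2, h3⟩ := MannaStep.iff_exists.1 hpq
    rw [hpop] at h2
    refine MannaStep.iff_exists.2 ⟨c, z, h1, h2, ?_⟩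
    funext y
    simp only [h3, Pi.add_apply]
    by_cases hy : y = z
    · subst hy
      simp [add_right_comm]
    · simp [hy]

end Combinatorics

section Stacks

open Set

instance : Fintype Label3 :=
  ⟨{Label3.l, Label3.r, Label3.s}, by rintro (_ | _ | _) <;> simp⟩

instance : DiscreteMeasurableSpace Label3 := ⟨fun _ => trivial⟩

lemma sum_label_eq {M : Type*} [AddCommMonoid M] (g : Label3 → M) :
    ∑ a, g a = g Label3.l + (g Label3.r + g Label3.s) := by
  change ∑ a ∈ {Label3.l, Label3.r, Label3.s}, g a = _
  simp

lemma labelP_eq_ofReal (a : Label3) : ∃ p : ℝ, 0 < p ∧ labelP a = ENNReal.ofReal p := by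
  cases a
  · exact ⟨1 / 4, by norm_num, by
      rw [ENNReal.ofReal_div_of_pos (by norm_num)]; simp [labelP]⟩
  · exact ⟨1 / 4, by norm_num, by
      rw [ENNReal.ofReal_div_of_pos (by norm_num)]; simp [labelP]⟩
  · exact ⟨1 / 2, by norm_num, by
      rw [ENNReal.ofReal_div_of_pos (by norm_num)]; simp [labelP]⟩

lemma labelP_pos (a : Label3) : 0 < (labelP a).toReal := by
  obtain ⟨p, hp, h⟩ := labelP_eq_ofReal a
  rwa [h, ENNReal.toReal_ofReal hp.le]

lemma labelP_ne_top (a : Label3) : labelP a ≠ ⊤ := by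
  obtain ⟨p, hp, h⟩ := labelP_eq_ofReal a
  rw [h]
  exact ENNReal.ofReal_ne_top

lemma sum_labelP : ∑ a, labelP a = 1 := by
  rw [sum_label_eq]
  simp only [labelP]
  rw [← ENNReal.toReal_eq_one_iff, ENNReal.toReal_add (by simp) (by simp),
    ENNReal.toReal_add (by simp) (by simp)]
  norm_num

lemma measurable_pushLabel (a : Label3) : Measurable (pushLabel a) := by
  refine measurable_pi_iff.2 fun k => ?_
  cases k with
  | zero => exact measurable_const
  | succ k => exact measurable_pi_apply k

/-- Stacks whose top label and labels at the positions `j + 1`, `j ∈ T`, are prescribed. -/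
def stackCylinder (T : Finset ℕ) (w : ℕ → Label3) : Set (ℕ → Label3) :=
  {f | f 0 = w 0 ∧ ∀ j ∈ T, f (j + 1) = w (j + 1)}

lemma isPiSystem_stackCylinder :
    IsPiSystem {s | ∃ T w, s = stackCylinder T w} := by
  rintro _ ⟨T, w, rfl⟩ _ ⟨T', w', rfl⟩ ⟨g, hg, hg'⟩
  refine ⟨T ∪ T', g, ?_⟩
  ext f
  simp only [stackCylinder, mem_inter_iff, mem_ofPred_eq, Finset.mem_union] at *
  constructor
  · rintro ⟨⟨h1, h2⟩, h3, h4⟩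
    refine ⟨h1.trans hg.1.symm, ?_⟩
    rintro j (hj | hj)
    · rw [h2 j hj, hg.2 j hj]
    · rw [h4 j hj, hg'.2 j hj]
  · rintro ⟨h1, h2⟩
    exact ⟨⟨h1.trans hg.1, fun j hj => by rw [h2 j (.inl hj), hg.2 j hj]⟩,
      h1.trans hg'.1, fun j hj => by rw [h2 j (.inr hj), hg'.2 j hj]⟩

lemma generateFrom_stackCylinder :
    (MeasurableSpace.pi : MeasurableSpace (ℕ → Label3)) =
      MeasurableSpace.generateFrom {s | ∃ T w, s = stackCylinder T w} := by
  apply le_antisymm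
  · refine iSup_le fun i => ?_
    rw [← measurable_iff_comap_le]
    refine @measurable_to_countable' Label3 (ℕ → Label3) _ _
      (MeasurableSpace.generateFrom _) _ fun a => ?_
    cases i with
    | zero =>
      refine MeasurableSpace.measurableSet_generateFrom ⟨∅, fun _ => a, ?_⟩
      ext f
      simp [stackCylinder]
    | succ k =>
      have : (fun f : ℕ → Label3 => f (k + 1)) ⁻¹' {a} =
          ⋃ c, stackCylinder {k} (pushLabel c fun _ => a) := by
        ext f
        simp [stackCylinder, pushLabel]
      rw [this]
      exact @MeasurableSet.iUnion _ _ (MeasurableSpace.generateFrom _) _ _ fun c =>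
        MeasurableSpace.measurableSet_generateFrom ⟨_, _, rfl⟩
  · refine MeasurableSpace.generateFrom_le ?_
    rintro _ ⟨T, w, rfl⟩
    have : stackCylinder T w = (fun f => f 0) ⁻¹' {w 0} ∩
        ⋂ j ∈ T, (fun f => f (j + 1)) ⁻¹' {w (j + 1)} := by
      ext f
      simp [stackCylinder]
    rw [this]
    exact (measurable_pi_apply 0 (measurableSet_singleton _)).inter
      (Finset.measurableSet_biInter _ fun j _ =>
        measurable_pi_apply (j + 1) (measurableSet_singleton _))

/-- In an i.i.d. stack the top label is independent of the remaining stack, which has the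
same law. -/
lemma eq_sum_map_pushLabel {κ : Measure (ℕ → Label3)} [IsProbabilityMeasure κ]
    (hκ : ∀ (S : Finset ℕ) (w : ℕ → Label3),
      κ {f | ∀ i ∈ S, f i = w i} = ∏ i ∈ S, labelP (w i)) :
    κ = ∑ a, labelP a • κ.map (pushLabel a) := by
  refine ext_of_generate_finite _ generateFrom_stackCylinder isPiSystem_stackCylinder ?_ ?_
  · rintro _ ⟨T, w, rfl⟩
    have hmeas : MeasurableSet (stackCylinder T w) := by
      rw [generateFrom_stackCylinder]
      exact MeasurableSpace.measurableSet_generateFrom ⟨_, _, rfl⟩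
    rw [Measure.finsetSum_apply, Finset.sum_eq_single (w 0)]
    · have h1 : stackCylinder T w =
          {f | ∀ i ∈ insert 0 (T.map ⟨Nat.succ, Nat.succ_injective⟩), f i = w i} := by
        ext f
        simp [stackCylinder]
      have h2 : pushLabel (w 0) ⁻¹' stackCylinder T w = {f | ∀ j ∈ T, f j = w (j + 1)} := by
        ext f
        simp [stackCylinder, pushLabel]
      rw [Measure.smul_apply, Measure.map_apply (measurable_pushLabel _) hmeas, h2,
        hκ T fun j => w (j + 1), h1, hκ, Finset.prod_insert (by simp), Finset.prod_map]
      rfl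
    · intro a _ ha
      have : pushLabel a ⁻¹' stackCylinder T w = ∅ := by
        ext f
        simp [stackCylinder, pushLabel, ha]
      rw [Measure.smul_apply, Measure.map_apply (measurable_pushLabel _) hmeas, this]
      simp
    · simp
  · rw [Measure.finsetSum_apply]
    simp only [Measure.smul_apply, Measure.map_apply (measurable_pushLabel _) MeasurableSet.univ,
      preimage_univ, measure_univ, smul_eq_mul, mul_one, sum_labelP]

variable {n : ℕ}

lemma measurable_pushAt (x : ZMod (n + 1)) (a : Label3) : Measurable (pushAt x a) := by
  refine measurable_pi_iff.2 fun y => ?_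
  by_cases hy : y = x
  · subst hy
    simpa [pushAt, Function.comp_def] using
      (measurable_pushLabel a).comp (measurable_pi_apply y)
  · simpa [pushAt, hy] using measurable_pi_apply y

lemma measurable_popAt (x : ZMod (n + 1)) : Measurable (popAt x) := by
  refine measurable_pi_iff.2 fun y => ?_
  by_cases hy : y = x
  · subst hy
    simp only [popAt, Function.update_self]
    exact measurable_pi_iff.2 fun k => (measurable_pi_apply (k + 1)).comp (measurable_pi_apply y)
  · simpa [popAt, hy] using measurable_pi_apply y

lemma pi_eq_sum_map_pushAt {κ : Measure (ℕ → Label3)} [IsProbabilityMeasure κ]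
    (hκ : κ = ∑ a, labelP a • κ.map (pushLabel a)) (x : ZMod (n + 1)) :
    (Measure.pi fun _ : ZMod (n + 1) => κ) =
      ∑ a, labelP a • (Measure.pi fun _ : ZMod (n + 1) => κ).map (pushAt x a) := by
  refine Measure.pi_eq fun s hs => ?_
  have hpre : ∀ a, pushAt x a ⁻¹' univ.pi s =
      univ.pi (Function.update s x (pushLabel a ⁻¹' s x)) := by
    intro a
    ext σ
    simp only [mem_preimage, mem_univ_pi]
    refine forall_congr' fun y => ?_
    by_cases hy : y = x
    · subst hy
      simp [pushAt]
    · simp [pushAt, hy]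
  have hterm : ∀ a, (labelP a • (Measure.pi fun _ : ZMod (n + 1) => κ).map (pushAt x a))
      (univ.pi s) = (labelP a * κ (pushLabel a ⁻¹' s x)) * ∏ y ∈ Finset.univ.erase x, κ (s y) := by
    intro a
    rw [Measure.smul_apply, Measure.map_apply (measurable_pushAt x a) (.univ_pi hs), hpre,
      Measure.pi_pi, ← Finset.mul_prod_erase _ _ (Finset.mem_univ x), smul_eq_mul, mul_assoc,
      Function.update_self]
    congr 2
    refine Finset.prod_congr rfl fun y hy => ?_
    rw [Function.update_of_ne (Finset.ne_of_mem_erase hy)]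
  rw [Measure.finsetSum_apply, Finset.sum_congr rfl fun a _ => hterm a, ← Finset.sum_mul,
    ← Finset.mul_prod_erase _ _ (Finset.mem_univ x)]
  congr 1
  conv_rhs => rw [hκ]
  rw [Measure.finsetSum_apply]
  refine Finset.sum_congr rfl fun a _ => ?_
  rw [Measure.smul_apply, Measure.map_apply (measurable_pushLabel a) (hs x), smul_eq_mul]

/-- The stacks for which `η` is not stabilizable. -/
def badStacks (η : ZMod (n + 1) → ℕ) : Set (ZMod (n + 1) → ℕ → Label3) :=
  {σ | ¬ MannaStabilizable n η σ}

lemma measure_badStacks_le {κ : Measure (ℕ → Label3)} [IsProbabilityMeasure κ]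
    (hκ : κ = ∑ a, labelP a • κ.map (pushLabel a)) (b : ZMod (n + 1) → ℕ) (x : ZMod (n + 1)) :
    (Measure.pi fun _ : ZMod (n + 1) => κ) (badStacks (b + oneAt x + oneAt x)) ≤
      ∑ a, labelP a * (Measure.pi fun _ : ZMod (n + 1) => κ) (badStacks (b + emitted x a)) := by
  set μ := Measure.pi fun _ : ZMod (n + 1) => κ with hμ
  let B : Label3 → Set (ZMod (n + 1) → ℕ → Label3) := fun a =>
    toMeasurable μ (badStacks (b + emitted x a))
  let D : Set (ZMod (n + 1) → ℕ → Label3) := ⋃ a, (fun σ => σ x 0) ⁻¹' {a} ∩ popAt x ⁻¹' B a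
  have hD : MeasurableSet D := MeasurableSet.iUnion fun a =>
    (((measurable_pi_apply 0).comp (measurable_pi_apply x)) (measurableSet_singleton a)).inter
      (measurable_popAt x (measurableSet_toMeasurable _ _))
  have hsub : badStacks (b + oneAt x + oneAt x) ⊆ D := by
    intro σ hσ
    refine mem_iUnion.2 ⟨σ x 0, rfl, subset_toMeasurable _ _ fun h => hσ h.of_popAt⟩
  have hpre : ∀ a, pushAt x a ⁻¹' D = B a := by
    intro a
    ext σ
    simp [D, popAt_pushAt, show pushAt x a σ x 0 = a by simp [pushAt, pushLabel]]
  calc μ (badStacks (b + oneAt x + oneAt x)) ≤ μ D := measure_mono hsub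
    _ = ∑ a, labelP a * μ (B a) := by
      conv_lhs => rw [hμ, pi_eq_sum_map_pushAt hκ x]
      rw [Measure.finsetSum_apply]
      refine Finset.sum_congr rfl fun a _ => ?_
      rw [Measure.smul_apply, Measure.map_apply (measurable_pushAt x a) hD, hpre, smul_eq_mul]
    _ = _ := by simp only [B, measure_toMeasurable]

/-- By the maximum principle, with fewer particles than sites almost every choice of the stacks
makes the configuration stabilizable. -/
lemma measure_badStacks_eq_zero {κ : Measure (ℕ → Label3)} [IsProbabilityMeasure κ]
    (hκ : κ = ∑ a, labelP a • κ.map (pushLabel a)) (η : ZMod (n + 1) → ℕ) (hη : ∑ y, η y ≤ n) :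
    (Measure.pi fun _ : ZMod (n + 1) => κ) (badStacks η) = 0 := by
  set μ := Measure.pi fun _ : ZMod (n + 1) => κ with hμ
  have hfin : {ζ : ZMod (n + 1) → ℕ | ∑ y, ζ y ≤ n}.Finite := by
    refine (Set.Finite.pi' fun _ : ZMod (n + 1) => finite_Iic n).subset fun ζ hζ y => ?_
    exact (Finset.single_le_sum (fun _ _ => Nat.zero_le _) (Finset.mem_univ y)).trans hζ
  obtain ⟨ξ, hξ, hmax⟩ := exists_max_image _ (fun ζ => μ (badStacks ζ)) hfin ⟨η, hη⟩
  have hstep : ∀ ζ ζ', Topples ζ ζ' → ∑ y, ζ y ≤ n → μ (badStacks ζ) = μ (badStacks ξ) →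
      μ (badStacks ζ') = μ (badStacks ξ) := by
    intro ζ ζ' h hζ heq
    have hle : ∀ c, Topples ζ c → μ.real (badStacks c) ≤ μ.real (badStacks ξ) := fun c hc =>
      ENNReal.toReal_mono (measure_ne_top _ _) (hmax c (hc.sum_eq.trans_le hζ))
    obtain ⟨b, x, a, rfl, rfl⟩ := h
    have h1 := measure_badStacks_le hκ b x
    rw [← hμ, heq] at h1
    have h2 : μ.real (badStacks ξ) ≤
        ∑ a, (labelP a).toReal * μ.real (badStacks (b + emitted x a)) := by
      have h3 := ENNReal.toReal_mono (ENNReal.sum_ne_top.2 fun a _ =>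
        ENNReal.mul_ne_top (labelP_ne_top a) (measure_ne_top _ _)) h1
      rwa [ENNReal.toReal_sum fun a _ =>
        ENNReal.mul_ne_top (labelP_ne_top a) (measure_ne_top _ _),
        Finset.sum_congr rfl fun a _ => ENNReal.toReal_mul] at h3
    have h4 : ∑ a, (labelP a).toReal = 1 := by
      rw [← ENNReal.toReal_sum fun a _ => labelP_ne_top a, sum_labelP, ENNReal.toReal_one]
    have h5 : ∀ c, (labelP c).toReal * μ.real (badStacks (b + emitted x c)) ≤
        (labelP c).toReal * μ.real (badStacks ξ) := fun c =>
      mul_le_mul_of_nonneg_left (hle _ ⟨b, x, c, rfl, rfl⟩) (labelP_pos c).le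
    have h6 : ∑ c, (labelP c).toReal * μ.real (badStacks (b + emitted x c)) =
        ∑ c, (labelP c).toReal * μ.real (badStacks ξ) := by
      refine le_antisymm (Finset.sum_le_sum fun c _ => h5 c) ?_
      rwa [← Finset.sum_mul, h4, one_mul]
    have h7 := (Finset.sum_eq_sum_iff_of_le fun c _ => h5 c).1 h6 a (Finset.mem_univ a)
    exact (measureReal_eq_measureReal_iff).1 (mul_left_cancel₀ (labelP_pos a).ne' h7)
  obtain ⟨ζ, hζ, hst⟩ := exists_reflTransGen_topples_stable ξ hξ
  have hpath : ∀ ζ, Relation.ReflTransGen Topples ξ ζ → μ (badStacks ζ) = μ (badStacks ξ) := by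
    intro ζ h
    induction h with
    | refl => rfl
    | tail h h' ih => exact hstep _ _ h' ((reflTransGen_topples_sum_eq h).trans_le hξ) ih
  have hzero : badStacks ζ = ∅ :=
    eq_empty_of_forall_notMem fun σ hσ => hσ ⟨(ζ, fun _ => 0), .refl, hst⟩
  have := hmax η hη
  simp only [← hpath ζ hζ, hzero, measure_empty] at this
  exact nonpos_iff_eq_zero.1 this

end Stacks

section Poisson

variable {n : ℕ}

lemma lintegral_pow_of_poisson {P : Measure ℕ} {ρ t : ℝ} (hρ : 0 < ρ) (ht : 0 < t)
    (hP : ∀ k : ℕ, P {k} = ENNReal.ofReal (Real.exp (-ρ) * ρ ^ k / k.factorial)) :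
    ∫⁻ k, ENNReal.ofReal (t ^ k) ∂P = ENNReal.ofReal (Real.exp (ρ * (t - 1))) := by
  have hsum : HasSum (fun k : ℕ => t ^ k * (Real.exp (-ρ) * ρ ^ k / k.factorial))
      (Real.exp (ρ * (t - 1))) := by
    have h := (NormedSpace.expSeries_div_hasSum_exp (ρ * t : ℝ)).mul_left (Real.exp (-ρ))
    rw [← Real.exp_eq_exp_ℝ, ← Real.exp_add] at h
    convert! h using 1
    · funext k
      rw [mul_pow]
      ring
    · congr 1
      ring
  rw [lintegral_countable', ← hsum.tsum_eq,
    ENNReal.ofReal_tsum_of_nonneg (fun k => by positivity) hsum.summable]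
  refine tsum_congr fun k => ?_
  rw [hP, ENNReal.ofReal_mul (by positivity)]

/-- A Chernoff bound for the total number of particles. -/
lemma measure_pow_le_pow_sum_le {P : Measure ℕ} [IsProbabilityMeasure P] {ρ t : ℝ}
    (hρ : 0 < ρ) (ht : 0 < t)
    (hP : ∀ k : ℕ, P {k} = ENNReal.ofReal (Real.exp (-ρ) * ρ ^ k / k.factorial)) :
    (Measure.pi fun _ : ZMod (n + 1) => P) {η | t ^ (n + 1) ≤ t ^ ∑ y, η y} ≤
      ENNReal.ofReal ((Real.exp (ρ * (t - 1)) / t) ^ (n + 1)) := by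
  set μ := Measure.pi fun _ : ZMod (n + 1) => P
  have hprod : ∫⁻ η, ∏ y, ENNReal.ofReal (t ^ η y) ∂μ =
      ENNReal.ofReal (Real.exp (ρ * (t - 1)) ^ (n + 1)) := by
    have hmeas : Measurable fun k : ℕ => ENNReal.ofReal (t ^ k) := measurable_from_top
    rw [ProbabilityTheory.lintegral_prod_eq_prod_lintegral_of_indepFun Finset.univ
      (fun y (η : ZMod (n + 1) → ℕ) => ENNReal.ofReal (t ^ η y))
      (ProbabilityTheory.iIndepFun_pi fun _ => hmeas.aemeasurable)
      (fun y => hmeas.comp (measurable_pi_apply y))]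
    have : ∀ y, ∫⁻ η, ENNReal.ofReal (t ^ η y) ∂μ =
        ENNReal.ofReal (Real.exp (ρ * (t - 1))) := fun y => by
      rw [← lintegral_pow_of_poisson hρ ht hP]
      exact (measurePreserving_eval (fun _ : ZMod (n + 1) => P) y).lintegral_comp hmeas
    rw [Finset.prod_congr rfl fun y _ => this y, Finset.prod_const, Finset.card_univ, ZMod.card,
      ENNReal.ofReal_pow (Real.exp_pos _).le]
  have hmarkov := mul_meas_ge_le_lintegral (μ := μ)
    (f := fun η => ∏ y, ENNReal.ofReal (t ^ η y))
    (Finset.measurable_fun_prod _ fun y _ =>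
      (measurable_from_top (f := fun k : ℕ => ENNReal.ofReal (t ^ k))).comp
        (measurable_pi_apply y))
    (ENNReal.ofReal (t ^ (n + 1)))
  have hset : {η : ZMod (n + 1) → ℕ | t ^ (n + 1) ≤ t ^ ∑ y, η y} =
      {η | ENNReal.ofReal (t ^ (n + 1)) ≤ ∏ y, ENNReal.ofReal (t ^ η y)} := by
    ext η
    rw [Set.mem_ofPred_eq, Set.mem_ofPred_eq, ← ENNReal.ofReal_prod_of_nonneg fun y _ => by positivity, Finset.prod_pow_eq_pow_sum,
      ENNReal.ofReal_le_ofReal_iff (by positivity)]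
  rw [hset, div_pow, ENNReal.ofReal_div_of_pos (by positivity), ← hprod,
    ENNReal.le_div_iff_mul_le (by simp [ht]) (by simp), mul_comm]
  exact hmarkov

lemma exp_mul_sub_one_div_lt_one {ρ : ℝ} (hρ : 0 < ρ) (h1 : ρ ≠ 1) :
    Real.exp (ρ * (ρ⁻¹ - 1)) / ρ⁻¹ < 1 := by
  have h : ρ < Real.exp (ρ - 1) := by
    linarith [Real.add_one_lt_exp (sub_ne_zero.2 h1)]
  have h2 : ρ * (ρ⁻¹ - 1) = -(ρ - 1) := by
    field_simp
    ring
  rw [h2, Real.exp_neg, div_inv_eq_mul, inv_mul_lt_one₀ (Real.exp_pos _)]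
  exact h

lemma tendsto_chernoff_bound {ρ : ℝ} (hρ : 0 < ρ) (h1 : ρ ≠ 1) :
    Tendsto (fun n : ℕ => (Real.exp (ρ * (ρ⁻¹ - 1)) / ρ⁻¹) ^ (n + 1)) atTop (𝓝 0) :=
  (tendsto_pow_atTop_nhds_zero_of_lt_one (by positivity)
    (exp_mul_sub_one_div_lt_one hρ h1)).comp (tendsto_add_atTop_nat 1)

/-- Stabilizability is unlikely at supercritical density, uniformly in `ρ ≥ ρ₀ > 1`. -/
lemma measure_stabilizable_le {P : Measure ℕ} [IsProbabilityMeasure P]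
    {κ : Measure (ℕ → Label3)} [IsProbabilityMeasure κ] {ρ₀ ρ : ℝ} (hρ₀ : 1 < ρ₀)
    (hρ : ρ₀ ≤ ρ)
    (hP : ∀ k : ℕ, P {k} = ENNReal.ofReal (Real.exp (-ρ) * ρ ^ k / k.factorial)) :
    ((Measure.pi fun _ : ZMod (n + 1) => P).prod (Measure.pi fun _ : ZMod (n + 1) => κ))
      {p | MannaStabilizable n p.1 p.2} ≤
      ENNReal.ofReal ((Real.exp (ρ₀ * (ρ₀⁻¹ - 1)) / ρ₀⁻¹) ^ (n + 1)) := by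
  have h0 : 0 < ρ₀ := one_pos.trans hρ₀
  have hinv : ρ₀⁻¹ ≤ 1 := inv_le_one_of_one_le₀ hρ₀.le
  calc _ ≤ ((Measure.pi fun _ : ZMod (n + 1) => P).prod (Measure.pi fun _ : ZMod (n + 1) => κ))
        ({η | ρ₀⁻¹ ^ (n + 1) ≤ ρ₀⁻¹ ^ ∑ y, η y} ×ˢ Set.univ) :=
      measure_mono fun p hp => ⟨pow_le_pow_of_le_one (by positivity) hinv hp.sum_le, trivial⟩
    _ ≤ ENNReal.ofReal ((Real.exp (ρ * (ρ₀⁻¹ - 1)) / ρ₀⁻¹) ^ (n + 1)) := by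
      rw [Measure.prod_prod, measure_univ, mul_one]
      exact measure_pow_le_pow_sum_le (h0.trans_le hρ) (by positivity) hP
    _ ≤ _ := by
      refine ENNReal.ofReal_le_ofReal (pow_le_pow_left₀ (by positivity) ?_ _)
      refine div_le_div_of_nonneg_right (Real.exp_le_exp.2 ?_) (by positivity)
      exact mul_le_mul_of_nonpos_right hρ (by linarith)

/-- Stabilizability is likely at subcritical density. -/
lemma one_sub_le_measure_stabilizable {P : Measure ℕ} [IsProbabilityMeasure P]
    {κ : Measure (ℕ → Label3)} [IsProbabilityMeasure κ]
    (hκ : κ = ∑ a, labelP a • κ.map (pushLabel a)) {ρ : ℝ} (hρ : 0 < ρ) (h1 : ρ < 1)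
    (hP : ∀ k : ℕ, P {k} = ENNReal.ofReal (Real.exp (-ρ) * ρ ^ k / k.factorial)) :
    1 - (Real.exp (ρ * (ρ⁻¹ - 1)) / ρ⁻¹) ^ (n + 1) ≤
      (((Measure.pi fun _ : ZMod (n + 1) => P).prod (Measure.pi fun _ : ZMod (n + 1) => κ))
        {p | MannaStabilizable n p.1 p.2}).toReal := by
  set μ := Measure.pi fun _ : ZMod (n + 1) => P
  set ν := Measure.pi fun _ : ZMod (n + 1) => κ
  set q := (Real.exp (ρ * (ρ⁻¹ - 1)) / ρ⁻¹) ^ (n + 1)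
  have hbad : (μ.prod ν) (⋃ η : {η : ZMod (n + 1) → ℕ // ∑ y, η y ≤ n},
      {η.1} ×ˢ badStacks η.1) = 0 := by
    refine measure_iUnion_null fun η => ?_
    rw [Measure.prod_prod, measure_badStacks_eq_zero hκ η.1 η.2, mul_zero]
  have hcover : (Set.univ : Set ((ZMod (n + 1) → ℕ) × (ZMod (n + 1) → ℕ → Label3))) ⊆
      ({p | MannaStabilizable n p.1 p.2} ∪
        {η | ρ⁻¹ ^ (n + 1) ≤ ρ⁻¹ ^ ∑ y, η y} ×ˢ Set.univ) ∪
        ⋃ η : {η : ZMod (n + 1) → ℕ // ∑ y, η y ≤ n}, {η.1} ×ˢ badStacks η.1 := by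
    rintro ⟨η, σ⟩ -
    by_cases hη : ∑ y, η y ≤ n
    · by_cases hs : MannaStabilizable n η σ
      · exact .inl (.inl hs)
      · exact .inr (Set.mem_iUnion.2 ⟨⟨η, hη⟩, rfl, hs⟩)
    · refine .inl (.inr ⟨pow_le_pow_right₀ ((one_le_inv₀ hρ).2 h1.le) (Nat.lt_of_not_le hη), trivial⟩)
  have hle : 1 ≤ (μ.prod ν) {p | MannaStabilizable n p.1 p.2} + ENNReal.ofReal q := by
    calc 1 = (μ.prod ν) Set.univ := measure_univ.symm
      _ ≤ _ := measure_mono hcover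
      _ ≤ _ := measure_union_le _ _
      _ ≤ ((μ.prod ν) {p | MannaStabilizable n p.1 p.2} +
          (μ.prod ν) ({η | ρ⁻¹ ^ (n + 1) ≤ ρ⁻¹ ^ ∑ y, η y} ×ˢ Set.univ)) + 0 :=
        add_le_add (measure_union_le _ _) hbad.le
      _ ≤ _ := by
        rw [add_zero, Measure.prod_prod, measure_univ, mul_one]
        gcongr
        exact measure_pow_le_pow_sum_le hρ (by positivity) hP
  have h2 := ENNReal.toReal_mono (by finiteness) hle
  rw [ENNReal.toReal_add (by finiteness) (by finiteness),
    ENNReal.toReal_ofReal (by positivity), ENNReal.toReal_one] at h2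
  linarith

end Poisson

/-- Proposition 4.1: for the fixed-energy Manna model on the
cycle `C_n` with i.i.d. Poisson(`ρ`) heights and i.i.d. stacks of labels
(`s` w.p. `1/2`, `l` and `r` w.p. `1/4`), the probability of stabilizability tends
to `1` as `n → ∞` for every `ρ < 1`, tends to `0` for every `ρ > 1`, and
consequently the threshold density `ρ_th = lim_n sup {ρ > 0 | P(stabilizable) ≥ 1/2}`
equals `1`. -/
theorem manna_threshold_density
    (P : ℝ → Measure ℕ)
    (hPprob : ∀ ρ : ℝ, 0 < ρ → IsProbabilityMeasure (P ρ))
    (hP : ∀ ρ : ℝ, 0 < ρ → ∀ k : ℕ,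
      P ρ {k} = ENNReal.ofReal (Real.exp (-ρ) * ρ ^ k / k.factorial))
    (κ : Measure (ℕ → Label3)) [IsProbabilityMeasure κ]
    (hκ : ∀ (S : Finset ℕ) (w : ℕ → Label3),
      κ {f | ∀ i ∈ S, f i = w i} = ∏ i ∈ S, labelP (w i)) :
    (∀ ρ : ℝ, 0 < ρ → ρ < 1 →
      Tendsto
        (fun n : ℕ =>
          (((Measure.pi fun _ : ZMod (n + 1) => P ρ).prod
              (Measure.pi fun _ : ZMod (n + 1) => κ))
            {p | MannaStabilizable n p.1 p.2}).toReal)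
        atTop (𝓝 1)) ∧
    (∀ ρ : ℝ, 1 < ρ →
      Tendsto
        (fun n : ℕ =>
          (((Measure.pi fun _ : ZMod (n + 1) => P ρ).prod
              (Measure.pi fun _ : ZMod (n + 1) => κ))
            {p | MannaStabilizable n p.1 p.2}).toReal)
        atTop (𝓝 0)) ∧
    Tendsto
      (fun n : ℕ => sSup {ρ : ℝ | 0 < ρ ∧
        (1 : ENNReal) / 2 ≤
          ((Measure.pi fun _ : ZMod (n + 1) => P ρ).prod
              (Measure.pi fun _ : ZMod (n + 1) => κ))
            {p | MannaStabilizable n p.1 p.2}})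
      atTop (𝓝 1) := by
  have hκ' := eq_sum_map_pushLabel hκ
  have hsub : ∀ ρ : ℝ, 0 < ρ → ρ < 1 →
      Tendsto
        (fun n : ℕ =>
          (((Measure.pi fun _ : ZMod (n + 1) => P ρ).prod
              (Measure.pi fun _ : ZMod (n + 1) => κ))
            {p | MannaStabilizable n p.1 p.2}).toReal)
        atTop (𝓝 1) := by
    intro ρ hρ h1
    have := hPprob ρ hρ
    refine tendsto_of_tendsto_of_tendsto_of_le_of_le
      (by simpa using (tendsto_chernoff_bound hρ h1.ne).const_sub 1) tendsto_const_nhds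
      (fun n => one_sub_le_measure_stabilizable hκ' hρ h1 (hP ρ hρ)) fun n => ?_
    exact ENNReal.toReal_mono ENNReal.one_ne_top prob_le_one
  refine ⟨hsub, ?_, ?_⟩
  · intro ρ h1
    have hρ : 0 < ρ := one_pos.trans h1
    have := hPprob ρ hρ
    refine squeeze_zero (fun n => ENNReal.toReal_nonneg) (fun n => ?_)
      (tendsto_chernoff_bound hρ h1.ne')
    exact ENNReal.toReal_le_of_le_ofReal (by positivity)
      (measure_stabilizable_le h1 le_rfl (hP ρ hρ))
  · have hupper : ∀ a : ℝ, 1 < a → ∀ᶠ n : ℕ in atTop, ∀ ρ ∈ {ρ : ℝ | 0 < ρ ∧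
        (1 : ENNReal) / 2 ≤
          ((Measure.pi fun _ : ZMod (n + 1) => P ρ).prod
              (Measure.pi fun _ : ZMod (n + 1) => κ))
            {p | MannaStabilizable n p.1 p.2}}, ρ ≤ a := by
      intro a ha
      have hlim := tendsto_chernoff_bound (one_pos.trans ha) ha.ne'
      filter_upwards [hlim.eventually_lt_const (show (0 : ℝ) < 1 / 2 by norm_num)] with n hn
      rintro ρ ⟨hρ, hhalf⟩
      by_contra! hlt
      have := hPprob ρ hρ
      have h := ENNReal.toReal_mono (by finiteness) hhalf
      have h' := ENNReal.toReal_le_of_le_ofReal (by positivity)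
        (measure_stabilizable_le (n := n) (κ := κ) ha hlt.le (hP ρ hρ))
      norm_num at h
      linarith
    refine tendsto_order.2 ⟨fun a ha => ?_, fun a ha => ?_⟩
    · obtain ⟨ρ, hρa, h1⟩ := exists_between (max_lt ha one_pos)
      have hρ : 0 < ρ := (le_max_right _ _).trans_lt hρa
      have := hPprob ρ hρ
      filter_upwards [hupper 2 one_lt_two,
        (hsub ρ hρ h1).eventually_const_lt (show (1 / 2 : ℝ) < 1 by norm_num)] with n hn hlt
      refine ((le_max_left _ _).trans_lt hρa).trans_le (le_csSup ⟨2, hn⟩ ⟨hρ, ?_⟩)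
      rw [← ENNReal.toReal_le_toReal (by finiteness) (by finiteness)]
      simpa using hlt.le
    · obtain ⟨b, hb, hba⟩ := exists_between ha
      filter_upwards [hupper b hb] with n hn
      exact (Real.sSup_le hn (one_pos.trans hb).le).trans_lt hba
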